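/- Let 0 < α < 1. Then E_{α,1}(i^{-α} t) ≠ 0 for all t > 0, where i^{-α} = exp(-iπα/2). -/

import Mathlib

open Complex Real

/-- The Mittag-Leffler function `E_{α,β}(z) = ∑ zⁿ / Γ(αn+β)`. -/
noncomputable def mlE (α β : ℝ) (z : ℂ) : ℂ :=
  ∑' n : ℕ, z ^ n / Complex.Gamma ((α * n + β : ℝ) : ℂ)

open MeasureTheory Filter Topology

lemma ml_gamma_lower (a : ℝ) (ha : 0 ≤ a) (M : ℝ) (hM : 0 < M) :
    M ^ a * Real.exp (-M) ≤ Real.Gamma (a + 1) := by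
  rw [Real.Gamma_eq_integral (by linarith)]
  have hint := Real.GammaIntegral_convergent (s := a + 1) (by linarith)
  have h1 : ∫ x in Set.Ioi M, M ^ a * Real.exp (-x) = M ^ a * Real.exp (-M) := by
    rw [integral_const_mul, integral_exp_neg_Ioi]
  rw [← h1]
  have hsub : Set.Ioi M ⊆ Set.Ioi (0 : ℝ) := Set.Ioi_subset_Ioi hM.le
  calc ∫ x in Set.Ioi M, M ^ a * Real.exp (-x)
      ≤ ∫ x in Set.Ioi M, Real.exp (-x) * x ^ (a + 1 - 1) := by
        apply setIntegral_mono_on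
        · exact (integrableOn_exp_neg_Ioi M).const_mul _
        · exact hint.mono_set hsub
        · exact measurableSet_Ioi
        · intro x hx
          have hx' : M < x := hx
          rw [mul_comm, add_sub_cancel_right]
          gcongr
    _ ≤ _ := by
        apply setIntegral_mono_set hint
        · filter_upwards [ae_restrict_mem measurableSet_Ioi] with x hx
          have hx' : 0 < x := hx
          positivity
        · exact hsub.eventuallyLE

lemma ml_summable (α : ℝ) (hα : 0 < α) (R : ℝ) (hR : 0 < R) :
    Summable (fun n : ℕ => R ^ n / Real.Gamma (α * n + 1)) := by
  set M : ℝ := (2 * R) ^ (1 / α) with hMdef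
  have hM : 0 < M := by positivity
  have hMa : M ^ α = 2 * R := by
    rw [hMdef, ← Real.rpow_mul (by positivity)]
    field_simp
    simp
  have hs : Summable (fun n : ℕ => Real.exp M * (1 / 2 : ℝ) ^ n) :=
    (summable_geometric_of_lt_one (by norm_num) (by norm_num)).mul_left _
  refine Summable.of_nonneg_of_le (fun n => ?_) (fun n => ?_) hs
  · have : 0 < Real.Gamma (α * n + 1) := Real.Gamma_pos_of_pos (by positivity)
    positivity
  · have h := ml_gamma_lower (α * n) (by positivity) M hM
    have hp : 0 < Real.Gamma (α * n + 1) := Real.Gamma_pos_of_pos (by positivity)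
    rw [div_le_iff₀ hp]
    rw [Real.rpow_mul hM.le, hMa, Real.rpow_natCast] at h
    calc R ^ n = Real.exp M * (1 / 2) ^ n * ((2 * R) ^ n * Real.exp (-M)) := by
          rw [mul_pow, Real.exp_neg]
          field_simp
          rw [← mul_pow]
          norm_num
      _ ≤ _ := by gcongr

lemma ml_term_norm (α : ℝ) (hα : 0 < α) (z : ℂ) (n : ℕ) :
    ‖z ^ n / Complex.Gamma ((α * n + 1 : ℝ) : ℂ)‖ = ‖z‖ ^ n / Real.Gamma (α * n + 1) := by
  have hp : 0 < Real.Gamma (α * n + 1) := Real.Gamma_pos_of_pos (by positivity)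
  rw [Complex.Gamma_ofReal, norm_div, norm_pow, Complex.norm_real, Real.norm_of_nonneg hp.le]

lemma ml_continuous (α : ℝ) (hα : 0 < α) : Continuous (mlE α 1) := by
  rw [continuous_iff_continuousAt]
  intro z
  have hc : ContinuousOn (mlE α 1) (Metric.ball 0 (‖z‖ + 1)) := by
    unfold mlE
    apply continuousOn_tsum (u := fun n : ℕ => (‖z‖ + 1) ^ n / Real.Gamma (α * n + 1))
    · intro n
      fun_prop
    · exact ml_summable α hα _ (by positivity)
    · intro n x hx
      rw [ml_term_norm α hα]
      have hp : 0 < Real.Gamma (α * n + 1) := Real.Gamma_pos_of_pos (by positivity)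
      have : ‖x‖ ≤ ‖z‖ + 1 := by simpa using (mem_ball_zero_iff.mp hx).le
      gcongr
  exact hc.continuousAt (Metric.isOpen_ball.mem_nhds (by simp))

lemma ml_zero (α : ℝ) : mlE α 1 0 = 1 := by
  unfold mlE
  rw [tsum_eq_single 0]
  · simp
  · intro n hn
    simp [hn]

/-- Laplace transform of `E_α(λ x^α)` for real `s > 1`. -/
lemma ml_laplace (α : ℝ) (hα : 0 < α) (l : ℂ) (hl : ‖l‖ = 1) (s : ℝ) (hs : 1 < s) :
    IntegrableOn (fun x : ℝ => (Real.exp (-(s * x)) : ℂ) * mlE α 1 (l * (x ^ α : ℝ))) (Set.Ioi 0) ∧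
    ∫ x in Set.Ioi (0:ℝ), (Real.exp (-(s * x)) : ℂ) * mlE α 1 (l * (x ^ α : ℝ)) =
      (s : ℂ)⁻¹ * (1 - l * ((s ^ α : ℝ) : ℂ)⁻¹)⁻¹ := by
  have hs0 : 0 < s := by linarith
  set f : ℕ → ℝ → ℂ := fun n x =>
    (l ^ n / (Real.Gamma (α * n + 1) : ℂ)) * ((x ^ (α * n + 1 - 1) * Real.exp (-(s * x)) : ℝ) : ℂ) with hf
  have hG : ∀ n : ℕ, 0 < Real.Gamma (α * n + 1) := fun n => Real.Gamma_pos_of_pos (by positivity)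
  have hval : ∀ n : ℕ, ∫ t in Set.Ioi (0:ℝ), t ^ (α * n + 1 - 1) * Real.exp (-(s * t)) =
      (1 / s) ^ (α * n + 1) * Real.Gamma (α * n + 1) := fun n =>
    Real.integral_rpow_mul_exp_neg_mul_Ioi (by positivity) hs0
  have hint0 : ∀ n : ℕ, IntegrableOn (fun t : ℝ => t ^ (α * n + 1 - 1) * Real.exp (-(s * t))) (Set.Ioi 0) := by
    intro n
    by_contra hcon
    have h0 := integral_undef hcon
    rw [hval n] at h0
    have := hG n
    have : 0 < (1 / s) ^ (α * n + 1) * Real.Gamma (α * n + 1) := by positivity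
    linarith
  have hint : ∀ n, IntegrableOn (f n) (Set.Ioi 0) := fun n => ((hint0 n).ofReal).const_mul _
  have hsum_eq : ∀ x ∈ Set.Ioi (0:ℝ), (Real.exp (-(s * x)) : ℂ) * mlE α 1 (l * (x ^ α : ℝ)) = ∑' n, f n x := by
    intro x hx
    have hx' : 0 < x := hx
    unfold mlE
    rw [← tsum_mul_left]
    congr 1
    ext n
    simp only [hf]
    rw [Complex.Gamma_ofReal, add_sub_cancel_right, Real.rpow_mul hx'.le, Real.rpow_natCast]
    push_cast
    ring
  have hnorm : ∀ n, ∫ x in Set.Ioi (0:ℝ), ‖f n x‖ = s⁻¹ * ((s ^ α)⁻¹) ^ n := by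
    intro n
    have : ∫ x in Set.Ioi (0:ℝ), ‖f n x‖ = ∫ x in Set.Ioi (0:ℝ), (Real.Gamma (α * n + 1))⁻¹ * (x ^ (α * n + 1 - 1) * Real.exp (-(s * x))) := by
      apply setIntegral_congr_fun measurableSet_Ioi
      intro x hx
      have hx' : 0 < x := hx
      simp only [hf]
      rw [norm_mul, norm_div, norm_pow, hl, Complex.norm_real, Complex.norm_real,
        Real.norm_of_nonneg (hG n).le, Real.norm_of_nonneg (by positivity)]
      simp
    rw [this, integral_const_mul, hval]
    have := (hG n).ne'
    rw [one_div, Real.inv_rpow hs0.le, Real.rpow_add hs0, Real.rpow_mul hs0.le, Real.rpow_natCast,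
      Real.rpow_one, inv_pow]
    field_simp
  have hsa : 1 < s ^ α := Real.one_lt_rpow hs hα
  have hsummable : Summable (fun n => ∫ x in Set.Ioi (0:ℝ), ‖f n x‖) := by
    simp_rw [hnorm]
    exact (summable_geometric_of_lt_one (by positivity) (inv_lt_one_of_one_lt₀ hsa)).mul_left _
  have hH := hasSum_integral_of_summable_integral_norm hint hsummable
  refine ⟨?_, ?_⟩
  · rw [integrableOn_congr_fun hsum_eq measurableSet_Ioi]
    refine ⟨?_, ?_⟩
    · have : ContinuousOn (fun x : ℝ => (Real.exp (-(s * x)) : ℂ) * mlE α 1 (l * (x ^ α : ℝ))) (Set.Ioi 0) := by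
        apply Continuous.continuousOn
        have h1 := ml_continuous α hα
        have h2 : Continuous (fun x : ℝ => x ^ α) := Real.continuous_rpow_const hα.le
        fun_prop
      exact (this.congr (fun x hx => (hsum_eq x hx).symm)).aestronglyMeasurable measurableSet_Ioi
    · rw [hasFiniteIntegral_iff_enorm]
      calc ∫⁻ x in Set.Ioi (0:ℝ), ‖∑' n, f n x‖ₑ ≤ ∫⁻ x in Set.Ioi (0:ℝ), ∑' n, ‖f n x‖ₑ := by
            apply lintegral_mono
            intro x
            exact enorm_tsum_le_tsum_enorm
        _ = ∑' n, ∫⁻ x in Set.Ioi (0:ℝ), ‖f n x‖ₑ :=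
            lintegral_tsum (fun n => (hint n).aestronglyMeasurable.enorm)
        _ = ∑' n, ENNReal.ofReal (∫ x in Set.Ioi (0:ℝ), ‖f n x‖) := by
            congr 1; ext n
            exact (ofReal_integral_norm_eq_lintegral_enorm (hint n)).symm
        _ < ⊤ := by
            rw [← ENNReal.ofReal_tsum_of_nonneg (fun n => by positivity) hsummable]
            exact ENNReal.ofReal_lt_top
  · rw [setIntegral_congr_fun measurableSet_Ioi hsum_eq, ← hH.tsum_eq]
    have : ∀ n, ∫ x in Set.Ioi (0:ℝ), f n x = (s:ℂ)⁻¹ * (l * ((s ^ α : ℝ) : ℂ)⁻¹) ^ n := by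
      intro n
      simp only [hf]
      rw [integral_const_mul, integral_complex_ofReal, hval]
      have := (hG n).ne'
      rw [one_div, Real.inv_rpow hs0.le, Real.rpow_add hs0, Real.rpow_mul hs0.le, Real.rpow_natCast,
        Real.rpow_one]
      have h2 : ((Real.Gamma (α * n + 1) : ℝ) : ℂ) ≠ 0 := by exact_mod_cast this
      push_cast
      field_simp
      rw [div_pow, div_div]
    simp_rw [this]
    rw [tsum_mul_left, tsum_geometric_of_norm_lt_one]
    rw [norm_mul, hl, one_mul, norm_inv, Complex.norm_real, Real.norm_of_nonneg (by positivity)]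
    exact inv_lt_one_of_one_lt₀ hsa

open FourierTransform in
lemma ml_laplace_unique (h : ℝ → ℂ)
    (hint : ∀ σ : ℝ, 1 < σ → IntegrableOn (fun x : ℝ => (Real.exp (-(σ * x)) : ℂ) * h x) (Set.Ioi 0))
    (hcont : ContinuousOn h (Set.Ioi 0))
    (hz : ∀ s : ℝ, 1 < s → ∫ x in Set.Ioi (0:ℝ), (Real.exp (-(s * x)) : ℂ) * h x = 0) :
    ∀ x : ℝ, 0 < x → h x = 0 := by
  set Lf : ℂ → ℂ := fun s => ∫ x in Set.Ioi (0:ℝ), Complex.exp (-(s * x)) * h x with hLf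
  have hmeas : AEStronglyMeasurable h (volume.restrict (Set.Ioi 0)) :=
    hcont.aestronglyMeasurable measurableSet_Ioi
  have hme : ∀ s : ℂ, AEStronglyMeasurable (fun x : ℝ => Complex.exp (-(s * x)) * h x) (volume.restrict (Set.Ioi 0)) := by
    intro s
    refine AEStronglyMeasurable.mul ?_ hmeas
    exact (by fun_prop : Continuous fun x : ℝ => Complex.exp (-(s * x))).aestronglyMeasurable
  have hnorm : ∀ (s : ℂ) (x : ℝ), ‖Complex.exp (-(s * x)) * h x‖ = Real.exp (-(s.re * x)) * ‖h x‖ := by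
    intro s x
    rw [norm_mul, Complex.norm_exp]
    simp
  have hintc : ∀ s : ℂ, 1 < s.re → IntegrableOn (fun x : ℝ => Complex.exp (-(s * x)) * h x) (Set.Ioi 0) := by
    intro s hs
    refine Integrable.mono (hint s.re hs) (hme s) ?_
    filter_upwards with x
    rw [hnorm, norm_mul, Complex.norm_real, Real.norm_of_nonneg (Real.exp_pos _).le]
  set U : Set ℂ := {s | 1 < s.re} with hU
  have hUo : IsOpen U := isOpen_lt continuous_const Complex.continuous_re
  have hdiff : DifferentiableOn ℂ Lf U := by
    intro s hs
    have hs' : 1 < s.re := hs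
    set ε : ℝ := (s.re - 1) / 4 with hε
    have hε0 : 0 < ε := by rw [hε]; linarith
    have := (hasDerivAt_integral_of_dominated_loc_of_deriv_le (μ := volume.restrict (Set.Ioi (0:ℝ)))
      (F := fun (s : ℂ) (x : ℝ) => Complex.exp (-(s * x)) * h x)
      (F' := fun (s : ℂ) (x : ℝ) => (Complex.exp (-(s * x)) * (-(1 * (x:ℂ)))) * h x)
      (bound := fun x => ε⁻¹ * ‖(Real.exp (-((s.re - 2 * ε) * x)) : ℂ) * h x‖)
      (x₀ := s) (s := Metric.ball s ε) (Metric.ball_mem_nhds s hε0)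
      (Filter.Eventually.of_forall hme) (hintc s hs') ?_ ?_ ?_ ?_).2
    · exact this.differentiableAt.differentiableWithinAt
    · refine AEStronglyMeasurable.mul ?_ hmeas
      exact (by fun_prop : Continuous fun x : ℝ => Complex.exp (-(s * x)) * (-(1 * (x:ℂ)))).aestronglyMeasurable
    · filter_upwards [ae_restrict_mem measurableSet_Ioi] with x hx z hz
      have hx' : 0 < x := hx
      rw [norm_mul, norm_mul, norm_mul, Complex.norm_exp, Complex.norm_real, Real.norm_of_nonneg (Real.exp_pos _).le]
      have h1 : s.re - ε ≤ z.re := by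
        have h2 : |(z - s).re| ≤ ‖z - s‖ := Complex.abs_re_le_norm _
        have h3 : ‖z - s‖ < ε := by simpa [dist_eq_norm] using hz
        have := abs_le.mp (h2.trans h3.le)
        simp at this
        linarith
      have h4 : ‖-(1 * (x:ℂ))‖ = x := by simp [abs_of_pos hx']
      rw [h4, ← mul_assoc]
      refine mul_le_mul_of_nonneg_right ?_ (norm_nonneg _)
      have h5 : (-(z * x)).re ≤ -((s.re - ε) * x) := by
        simp
        nlinarith
      have h6 : ε * x ≤ Real.exp (ε * x) := by linarith [Real.add_one_le_exp (ε * x)]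
      calc Real.exp (-(z * x)).re * x ≤ Real.exp (-((s.re - ε) * x)) * (ε⁻¹ * Real.exp (ε * x)) := by
            gcongr
            rw [inv_mul_eq_div, le_div_iff₀ hε0]
            linarith
        _ = ε⁻¹ * Real.exp (-((s.re - 2 * ε) * x)) := by
            rw [mul_left_comm, ← Real.exp_add]
            ring_nf
    · exact ((hint (s.re - 2 * ε) (by rw [hε]; linarith)).norm).const_mul _
    · filter_upwards with x z hz
      have := ((((hasDerivAt_id z).mul_const (x:ℂ)).neg).cexp).mul_const (h x)
      simpa using this
  have hconn : IsPreconnected U := (convex_halfSpace_re_gt 1).isPreconnected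
  have han : AnalyticOnNhd ℂ Lf U := hdiff.analyticOnNhd hUo
  have hreal : ∀ s : ℝ, 1 < s → Lf s = 0 := by
    intro s hs
    rw [← hz s hs]
    simp only [hLf]
    push_cast
    rfl
  have hzero : Set.EqOn Lf 0 U := by
    apply han.eqOn_zero_of_preconnected_of_frequently_eq_zero hconn (z₀ := ((2:ℝ):ℂ)) (by simp [hU])
    have ht : Tendsto (fun n : ℕ => (((2:ℝ) + 1 / ((n:ℝ) + 1) : ℝ) : ℂ)) atTop (𝓝[≠] ((2:ℝ):ℂ)) := by
      apply tendsto_nhdsWithin_iff.mpr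
      constructor
      · refine (Complex.continuous_ofReal.tendsto _).comp ?_
        simpa using (tendsto_one_div_add_atTop_nhds_zero_nat (𝕜 := ℝ)).const_add 2
      · filter_upwards with n
        simp only [Set.mem_compl_iff, Set.mem_singleton_iff]
        intro hh
        have h2 := Complex.ofReal_injective hh
        have : 0 < 1 / ((n:ℝ) + 1) := by positivity
        linarith
    refine ht.frequently ?_
    refine Filter.Frequently.of_forall ?_
    intro n
    apply hreal
    have : 0 < 1 / ((n:ℝ) + 1) := by positivity
    linarith
  set d : ℝ → ℂ := (Set.Ioi (0:ℝ)).indicator (fun x => Complex.exp (-((2:ℂ) * x)) * h x) with hd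
  have hdint : Integrable d := (integrable_indicator_iff measurableSet_Ioi).mpr (hintc 2 (by norm_num))
  have hF : 𝓕 d = fun _ => 0 := by
    ext w
    rw [Real.fourier_real_eq_integral_exp_smul]
    have h1 : (fun v : ℝ => Complex.exp (((-2 * Real.pi * v * w : ℝ) : ℂ) * Complex.I) • d v) =
        (Set.Ioi (0:ℝ)).indicator (fun x => Complex.exp (-(((2:ℂ) + 2 * Real.pi * w * Complex.I) * x)) * h x) := by
      ext v
      simp only [hd, Set.indicator]
      split_ifs
      · rw [smul_eq_mul, ← mul_assoc, ← Complex.exp_add]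
        congr 2
        push_cast
        ring
      · simp
    rw [h1, integral_indicator measurableSet_Ioi]
    exact hzero (show (1:ℝ) < ((2:ℂ) + 2 * Real.pi * w * Complex.I).re by simp)
  intro x hx
  have hca : ContinuousAt d x := by
    have : ContinuousAt (fun x : ℝ => Complex.exp (-((2:ℂ) * x)) * h x) x := by
      refine ContinuousAt.mul (by fun_prop) (hcont.continuousAt (Ioi_mem_nhds hx))
    refine this.congr ?_
    filter_upwards [Ioi_mem_nhds hx] with y hy
    simp only [hd]
    rw [Set.indicator_of_mem hy]
  have hinv := hdint.fourierInv_fourier_eq (by rw [hF]; exact integrable_zero _ _ _) hca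
  rw [hF] at hinv
  have h0 : d x = 0 := by
    rw [← hinv]
    simp [Real.fourierInv_eq]
  simp only [hd] at h0
  rw [Set.indicator_of_mem (show x ∈ Set.Ioi (0:ℝ) from hx)] at h0
  simpa using h0

/-- The denominator of the kernel. -/
noncomputable def mlD (α x : ℝ) : ℂ :=
  Complex.cosh (α * x + (Real.pi * α / 2 : ℝ) * Complex.I) - (Real.cos (Real.pi * α) : ℝ)

/-- The kernel. -/
noncomputable def mlK (α x : ℝ) : ℂ := ((Real.sin (Real.pi * α) / (2 * Real.pi) : ℝ) : ℂ) / mlD α x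

lemma mlD_eq (α x : ℝ) : mlD α x =
    ((Real.cosh (α * x) * Real.cos (Real.pi * α / 2) - Real.cos (Real.pi * α) : ℝ) : ℂ) +
    ((Real.sinh (α * x) * Real.sin (Real.pi * α / 2) : ℝ) : ℂ) * Complex.I := by
  unfold mlD
  rw [Complex.cosh_add, Complex.cosh_mul_I, Complex.sinh_mul_I]
  push_cast
  ring

lemma mlD_re (α x : ℝ) : (mlD α x).re =
    Real.cosh (α * x) * Real.cos (Real.pi * α / 2) - Real.cos (Real.pi * α) := by
  rw [mlD_eq]
  simp only [Complex.add_re, Complex.ofReal_re, Complex.re_ofReal_mul, Complex.I_re, mul_zero, add_zero]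

lemma mlD_im (α x : ℝ) : (mlD α x).im = Real.sinh (α * x) * Real.sin (Real.pi * α / 2) := by
  rw [mlD_eq]
  simp only [Complex.add_im, Complex.ofReal_im, Complex.im_ofReal_mul, Complex.I_im, mul_one, zero_add]

lemma mlD_neg (α x : ℝ) : mlD α (-x) = (starRingEnd ℂ) (mlD α x) := by
  apply Complex.ext
  · rw [Complex.conj_re, mlD_re, mlD_re]
    simp
  · rw [Complex.conj_im, mlD_im, mlD_im]
    simp

lemma mlK_neg (α x : ℝ) : mlK α (-x) = (starRingEnd ℂ) (mlK α x) := by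
  unfold mlK
  rw [mlD_neg, map_div₀, Complex.conj_ofReal]

lemma ml_cos_facts (α : ℝ) (h0 : 0 < α) (h1 : α < 1) :
    0 < Real.cos (Real.pi * α / 2) ∧ Real.cos (Real.pi * α / 2) < 1 ∧
    Real.cos (Real.pi * α) = 2 * Real.cos (Real.pi * α / 2) ^ 2 - 1 := by
  have hp := Real.pi_pos
  have hpa : 0 < Real.pi * α := by positivity
  have hpa1 : Real.pi * α < Real.pi := by nlinarith
  refine ⟨Real.cos_pos_of_mem_Ioo ⟨by linarith, by linarith⟩, ?_, ?_⟩
  · rw [← Real.cos_zero]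
    exact Real.cos_lt_cos_of_nonneg_of_le_pi le_rfl (by linarith) (by linarith)
  · rw [← Real.cos_two_mul]; congr 1; ring

lemma mlD_lower (α : ℝ) (h0 : 0 < α) (h1 : α < 1) :
    ∃ δ : ℝ, 0 < δ ∧ ∀ x, δ * Real.cosh (α * x) ≤ (mlD α x).re := by
  obtain ⟨hc0, hc1, hc2⟩ := ml_cos_facts α h0 h1
  set c := Real.cos (Real.pi * α / 2)
  refine ⟨min c (c - (2 * c ^ 2 - 1)), lt_min hc0 (by nlinarith), fun x => ?_⟩
  rw [mlD_re, hc2]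
  have hC := Real.one_le_cosh (α * x)
  rcases le_total 0 (2 * c ^ 2 - 1) with h | h
  · have := min_le_right c (c - (2 * c ^ 2 - 1))
    nlinarith
  · have := min_le_left c (c - (2 * c ^ 2 - 1))
    nlinarith

lemma mlD_ne (α : ℝ) (h0 : 0 < α) (h1 : α < 1) (x : ℝ) : mlD α x ≠ 0 := by
  obtain ⟨δ, hδ, h⟩ := mlD_lower α h0 h1
  intro hh
  have := h x
  rw [hh] at this
  have hC := Real.one_le_cosh (α * x)
  simp at this
  nlinarith

lemma mlK_cont (α : ℝ) (h0 : 0 < α) (h1 : α < 1) : Continuous (mlK α) := by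
  unfold mlK
  refine Continuous.div continuous_const ?_ (mlD_ne α h0 h1)
  unfold mlD
  fun_prop

lemma ml_cosh_lower (u : ℝ) : (1 + u ^ 2) / 2 ≤ Real.cosh u := by
  have := Real.cosh_sq u
  have h1 := Real.one_le_cosh u
  have h2 : Real.cosh u = 1 + 2 * Real.sinh (u / 2) ^ 2 := by
    have h3 : u = 2 * (u / 2) := by ring
    have h4 := Real.cosh_sq (u / 2)
    conv_lhs => rw [h3, Real.cosh_two_mul]
    linarith
  have h5 : (u / 2) ^ 2 ≤ Real.sinh (u / 2) ^ 2 := by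
    rw [sq_le_sq, Real.abs_sinh]
    exact Real.self_le_sinh_iff.mpr (abs_nonneg _)
  nlinarith

lemma ml_bound_integrable (α : ℝ) (h0 : 0 < α) :
    Integrable (fun x : ℝ => (Real.cosh (α * x))⁻¹) := by
  have h := (integrable_inv_one_add_sq.comp_mul_left' h0.ne').const_mul 2
  refine h.mono ?_ ?_
  · exact (Continuous.inv₀ (by fun_prop) (fun x => (Real.cosh_pos _).ne')).aestronglyMeasurable
  · filter_upwards with x
    have hc := Real.cosh_pos (α * x)
    rw [Real.norm_of_nonneg (by positivity), Real.norm_of_nonneg (by positivity)]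
    have := ml_cosh_lower (α * x)
    calc (Real.cosh (α * x))⁻¹ ≤ ((1 + (α * x) ^ 2) / 2)⁻¹ := by gcongr
      _ = _ := by rw [inv_div]; rfl

lemma mlK_integrable (α : ℝ) (h0 : 0 < α) (h1 : α < 1) : Integrable (mlK α) := by
  obtain ⟨δ, hδ, h⟩ := mlD_lower α h0 h1
  refine ((ml_bound_integrable α h0).const_mul (|Real.sin (Real.pi * α) / (2 * Real.pi)| / δ)).mono
    (mlK_cont α h0 h1).aestronglyMeasurable ?_
  filter_upwards with x
  have hc := Real.cosh_pos (α * x)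
  rw [Real.norm_of_nonneg (by positivity)]
  unfold mlK
  rw [norm_div, Complex.norm_real, Real.norm_eq_abs]
  have h2 : δ * Real.cosh (α * x) ≤ ‖mlD α x‖ := (h x).trans (Complex.re_le_norm _)
  calc _ ≤ |Real.sin (Real.pi * α) / (2 * Real.pi)| / (δ * Real.cosh (α * x)) := by gcongr
    _ = _ := by field_simp

/-- The integral part. -/
noncomputable def mlI (α X : ℝ) : ℂ := ∫ x : ℝ, mlK α x * (Real.exp (-(Real.exp x * X)) : ℝ)

lemma mlI_cont (α : ℝ) (h0 : 0 < α) (h1 : α < 1) : ContinuousOn (mlI α) (Set.Ici 0) := by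
  unfold mlI
  apply continuousOn_of_dominated (bound := fun x => ‖mlK α x‖)
  · intro X _
    have := mlK_cont α h0 h1
    exact (by fun_prop : Continuous fun x => mlK α x * (Real.exp (-(Real.exp x * X)) : ℝ)).aestronglyMeasurable
  · intro X hX
    have hX' : 0 ≤ X := hX
    filter_upwards with x
    rw [norm_mul, Complex.norm_real, Real.norm_of_nonneg (Real.exp_pos _).le]
    refine mul_le_of_le_one_right (norm_nonneg _) ?_
    rw [Real.exp_le_one_iff]
    have := Real.exp_pos x
    nlinarith
  · exact (mlK_integrable α h0 h1).norm
  · filter_upwards with x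
    fun_prop

lemma mlJ_laplace (α : ℝ) (h0 : 0 < α) (h1 : α < 1) (s : ℝ) (hs : 1 < s) :
    IntegrableOn (fun X : ℝ => (Real.exp (-(s * X)) : ℂ) * (Complex.exp (-Complex.I * X) / α - mlI α X)) (Set.Ioi 0) ∧
    ∫ X in Set.Ioi (0:ℝ), (Real.exp (-(s * X)) : ℂ) * (Complex.exp (-Complex.I * X) / α - mlI α X) =
      1 / (α * (s + Complex.I)) - ∫ x : ℝ, mlK α x / (s + Real.exp x : ℝ) := by
  have hre : (-(s + Complex.I)).re < 0 := by simp; linarith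
  have hA : ∀ X : ℝ, (Real.exp (-(s * X)) : ℂ) * (Complex.exp (-Complex.I * X) / α) =
      (α : ℂ)⁻¹ * Complex.exp ((-(s + Complex.I)) * X) := by
    intro X
    have : Complex.exp ((-(s + Complex.I)) * X) = Complex.exp (-(s * X)) * Complex.exp (-Complex.I * X) := by
      rw [← Complex.exp_add]; ring_nf
    rw [this]
    push_cast
    ring
  have hAi : IntegrableOn (fun X : ℝ => (Real.exp (-(s * X)) : ℂ) * (Complex.exp (-Complex.I * X) / α)) (Set.Ioi 0) := by
    simp_rw [hA]
    exact (integrableOn_exp_mul_complex_Ioi hre 0).const_mul _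
  have hAv : ∫ X in Set.Ioi (0:ℝ), (Real.exp (-(s * X)) : ℂ) * (Complex.exp (-Complex.I * X) / α) =
      1 / (α * (s + Complex.I)) := by
    simp_rw [hA]
    rw [integral_const_mul, integral_exp_mul_complex_Ioi hre]
    simp
    rw [neg_div, ← one_div, ← div_neg]
    ring
  set f : ℝ → ℝ → ℂ := fun X x => mlK α x * (Real.exp (-((s + Real.exp x) * X)) : ℝ) with hf
  have hprod : Integrable (Function.uncurry f) ((volume.restrict (Set.Ioi (0:ℝ))).prod volume) := by
    have hb : IntegrableOn (fun X : ℝ => Real.exp (-s * X)) (Set.Ioi 0) := integrableOn_exp_mul_Ioi (by linarith) 0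
    have hb2 := hb.mul_prod (mlK_integrable α h0 h1).norm
    refine hb2.mono ?_ ?_
    · have := mlK_cont α h0 h1
      apply Continuous.aestronglyMeasurable
      simp only [hf, Function.uncurry_def]
      fun_prop
    · have hae : ∀ᵐ p : ℝ × ℝ ∂((volume.restrict (Set.Ioi (0:ℝ))).prod volume), p.1 ∈ Set.Ioi (0:ℝ) :=
        Measure.quasiMeasurePreserving_fst.ae (ae_restrict_mem measurableSet_Ioi)
      filter_upwards [hae] with p hp
      have hp' : 0 < p.1 := hp
      simp only [hf, Function.uncurry_def]
      rw [norm_mul, norm_mul, norm_norm, Complex.norm_real, Real.norm_of_nonneg (Real.exp_pos _).le,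
        Real.norm_of_nonneg (Real.exp_pos _).le, mul_comm]
      gcongr
      have := Real.exp_pos p.2
      nlinarith
  have hB : ∀ X : ℝ, (Real.exp (-(s * X)) : ℂ) * mlI α X = ∫ x, f X x := by
    intro X
    unfold mlI
    rw [← integral_const_mul]
    congr 1
    ext x
    simp only [hf]
    have : Real.exp (-((s + Real.exp x) * X)) = Real.exp (-(s * X)) * Real.exp (-(Real.exp x * X)) := by
      rw [← Real.exp_add]; ring_nf
    rw [this]
    push_cast
    ring
  have hBi : IntegrableOn (fun X : ℝ => (Real.exp (-(s * X)) : ℂ) * mlI α X) (Set.Ioi 0) := by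
    simp_rw [hB]
    exact hprod.integral_prod_left
  have hBv : ∫ X in Set.Ioi (0:ℝ), (Real.exp (-(s * X)) : ℂ) * mlI α X = ∫ x : ℝ, mlK α x / (s + Real.exp x : ℝ) := by
    simp_rw [hB]
    rw [integral_integral_swap hprod]
    congr 1
    ext x
    simp only [hf]
    have hx := Real.exp_pos x
    rw [integral_const_mul, integral_complex_ofReal]
    have : ∫ X in Set.Ioi (0:ℝ), Real.exp (-((s + Real.exp x) * X)) = (s + Real.exp x)⁻¹ := by
      have := integral_exp_mul_Ioi (a := -(s + Real.exp x)) (by linarith) 0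
      simp only [neg_mul] at this
      rw [this]
      simp
      rw [neg_div, ← one_div, ← div_neg]
      congr 1
      ring
    rw [this]
    push_cast
    rfl
  simp_rw [mul_sub]
  refine ⟨hAi.sub hBi, ?_⟩
  rw [integral_sub hAi hBi, hAv, hBv]

lemma ml_log_lim (d : ℂ) (hd : 0 < d.im) :
    Tendsto (fun R : ℝ => ∫ x in (-R)..R, ((x:ℂ) + d)⁻¹) atTop (𝓝 (-(Real.pi * Complex.I))) := by
  have hslit : ∀ x : ℝ, (x:ℂ) + d ∈ Complex.slitPlane := by
    intro x
    right
    simp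
    exact hd.ne'
  have hne : ∀ x : ℝ, (x:ℂ) + d ≠ 0 := fun x => Complex.slitPlane_ne_zero (hslit x)
  have hI : ∀ R : ℝ, ∫ x in (-R)..R, ((x:ℂ) + d)⁻¹ = Complex.log (R + d) - Complex.log (-R + d) := by
    intro R
    rw [intervalIntegral.integral_eq_sub_of_hasDerivAt (f := fun x : ℝ => Complex.log (x + d))]
    · simp
    · intro x _
      have h1 : HasDerivAt (fun x : ℝ => (x:ℂ) + d) 1 x := (Complex.ofRealCLM.hasDerivAt).add_const d
      have := h1.clog_real (hslit x)
      simpa using this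
    · apply Continuous.intervalIntegrable
      exact Continuous.inv₀ (by fun_prop) hne
  have hlim : Tendsto (fun R : ℝ => Complex.log (1 + d / R) - Complex.log (-1 + d / R)) atTop
      (𝓝 (Complex.log 1 - Complex.log (-1))) := by
    have h0 : Tendsto (fun R : ℝ => d / (R:ℂ)) atTop (𝓝 0) := by
      have h := (Complex.continuous_ofReal.tendsto 0).comp (tendsto_inv_atTop_zero (𝕜 := ℝ))
      have := h.const_mul d
      simpa [div_eq_mul_inv] using this
    apply Tendsto.sub
    · have h1 : ContinuousAt Complex.log 1 := continuousAt_clog (by simp)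
      have h2 : Tendsto (fun R : ℝ => 1 + d / (R:ℂ)) atTop (𝓝 1) := by simpa using h0.const_add 1
      exact h1.tendsto.comp h2
    · have h1 := Complex.continuousWithinAt_log_of_re_neg_of_im_zero (z := -1) (by simp) (by simp)
      have h2 : Tendsto (fun R : ℝ => -1 + d / (R:ℂ)) atTop (𝓝[{z | 0 ≤ z.im}] (-1)) := by
        apply tendsto_nhdsWithin_iff.mpr
        refine ⟨by simpa using h0.const_add (-1), ?_⟩
        filter_upwards [eventually_gt_atTop 0] with R hR
        simp only [Set.mem_ofPred_eq, Complex.add_im, Complex.neg_im, Complex.one_im, Complex.div_ofReal_im]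
        have : 0 < d.im / R := by positivity
        linarith
      exact h1.tendsto.comp h2
  simp only [Complex.log_one, Complex.log_neg_one, zero_sub] at hlim
  refine hlim.congr' ?_
  filter_upwards [eventually_gt_atTop 0] with R hR
  rw [hI]
  have hRc : (R:ℂ) ≠ 0 := by exact_mod_cast hR.ne'
  have e1 : (R:ℂ) + d = R * (1 + d / R) := by field_simp
  have e2 : -(R:ℂ) + d = R * (-1 + d / R) := by field_simp
  have n1 : 1 + d / (R:ℂ) ≠ 0 := by
    intro h; rw [h, mul_zero] at e1; exact hne R e1
  have n2 : -1 + d / (R:ℂ) ≠ 0 := by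
    intro h; rw [h, mul_zero] at e2; exact hne (-R) (by push_cast; exact e2)
  rw [e1, e2, Complex.log_ofReal_mul hR n1, Complex.log_ofReal_mul hR n2]
  ring

lemma ml_log_lim_neg (d : ℂ) (hd : d.im < 0) :
    Tendsto (fun R : ℝ => ∫ x in (-R)..R, ((x:ℂ) + d)⁻¹) atTop (𝓝 (Real.pi * Complex.I)) := by
  have h := (ml_log_lim (-d) (by simpa using hd)).neg
  rw [neg_neg] at h
  refine h.congr (fun R => ?_)
  rw [← intervalIntegral.integral_neg]
  have := intervalIntegral.integral_comp_neg (a := -R) (b := R) (fun x : ℝ => ((x:ℂ) + d)⁻¹)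
  rw [neg_neg] at this
  rw [← this]
  congr 1
  ext x
  rw [← inv_neg]
  push_cast
  congr 1
  ring

/-- The open strip. -/
def mlS : Set ℂ := {y | |y.im| < 3 * Real.pi / 2}

lemma mlS_open : IsOpen mlS := isOpen_lt (by fun_prop) continuous_const

lemma ml_strip_zero (f : ℂ → ℂ) (hf : DifferentiableOn ℂ f mlS)
    (hv : ∀ ε > 0, ∀ᶠ R : ℝ in atTop, ∀ t : ℝ, |t| ≤ Real.pi →
      ‖f (R + t * Complex.I)‖ ≤ ε ∧ ‖f (-R + t * Complex.I)‖ ≤ ε) :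
    Tendsto (fun R : ℝ => (∫ x in (-R)..R, f (x - Real.pi * Complex.I)) -
      ∫ x in (-R)..R, f (x + Real.pi * Complex.I)) atTop (𝓝 0) := by
  have hp := Real.pi_pos
  rw [Metric.tendsto_atTop]
  intro ε hε
  obtain ⟨R0, hR0⟩ := Filter.eventually_atTop.mp (hv (ε / (8 * Real.pi)) (by positivity))
  refine ⟨R0, fun R hR => ?_⟩
  have hsub : (Set.uIcc (-R) R ×ℂ Set.uIcc (-Real.pi) Real.pi) ⊆ mlS := by
    intro z hz
    have h2 := (Complex.mem_reProdIm.mp hz).2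
    rw [Set.uIcc_of_le (by linarith)] at h2
    have : |z.im| ≤ Real.pi := abs_le.mpr h2
    simp only [mlS, Set.mem_ofPred_eq]
    linarith
  have hrect := Complex.integral_boundary_rect_eq_zero_of_differentiableOn f
    ((-R : ℝ) + (-Real.pi : ℝ) * Complex.I) ((R : ℝ) + (Real.pi : ℝ) * Complex.I)
    (hf.mono (by simpa using hsub))
  simp only [Complex.add_re, Complex.ofReal_re, Complex.re_ofReal_mul, Complex.I_re, mul_zero, add_zero,
    Complex.add_im, Complex.ofReal_im, Complex.im_ofReal_mul, Complex.I_im, mul_one, zero_add] at hrect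
  have b1 : ‖∫ y in (-Real.pi)..Real.pi, f (R + y * Complex.I)‖ ≤ ε / (8 * Real.pi) * |Real.pi - -Real.pi| := by
    apply intervalIntegral.norm_integral_le_of_norm_le_const
    intro y hy
    rw [Set.uIoc_of_le (by linarith)] at hy
    exact (hR0 R hR y (abs_le.mpr ⟨hy.1.le, hy.2⟩)).1
  have b2 : ‖∫ y in (-Real.pi)..Real.pi, f ((-R:ℝ) + y * Complex.I)‖ ≤ ε / (8 * Real.pi) * |Real.pi - -Real.pi| := by
    apply intervalIntegral.norm_integral_le_of_norm_le_const
    intro y hy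
    rw [Set.uIoc_of_le (by linarith)] at hy
    push_cast
    exact (hR0 R hR y (abs_le.mpr ⟨hy.1.le, hy.2⟩)).2
  have hval : ε / (8 * Real.pi) * |Real.pi - -Real.pi| = ε / 4 := by
    rw [abs_of_pos (by linarith)]
    field_simp
    norm_num
  rw [hval] at b1 b2
  have e1 : ∀ x : ℝ, (x:ℂ) + ((-Real.pi : ℝ) : ℂ) * Complex.I = x - Real.pi * Complex.I := by
    intro x; push_cast; ring
  simp_rw [e1] at hrect
  rw [dist_zero_right]
  have e2 : (∫ x in (-R)..R, f (x - Real.pi * Complex.I)) - ∫ x in (-R)..R, f (x + Real.pi * Complex.I) =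
      Complex.I * (∫ y in (-Real.pi)..Real.pi, f ((-R:ℝ) + y * Complex.I)) -
      Complex.I * ∫ y in (-Real.pi)..Real.pi, f (R + y * Complex.I) := by
    simp only [smul_eq_mul] at hrect
    linear_combination hrect
  rw [e2]
  calc _ ≤ _ := norm_sub_le _ _
    _ ≤ ε / 4 + ε / 4 := by
      rw [norm_mul, norm_mul, Complex.norm_I, one_mul, one_mul]
      gcongr
    _ < ε := by linarith

lemma ml_strip_removable (f : ℂ → ℂ) (p q : ℂ) (hpq : p ≠ q) (hp : |p.im| < Real.pi) (hq : |q.im| < Real.pi)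
    (hf : DifferentiableOn ℂ f (mlS \ {p, q}))
    (h1 : Tendsto (fun y => (y - p) * f y) (𝓝[≠] p) (𝓝 0))
    (h2 : Tendsto (fun y => (y - q) * f y) (𝓝[≠] q) (𝓝 0)) :
    ∃ F : ℂ → ℂ, DifferentiableOn ℂ F mlS ∧ ∀ y, y ≠ p → y ≠ q → F y = f y := by
  have hpi := Real.pi_pos
  have key : ∀ (f : ℂ → ℂ) (p : ℂ), Tendsto (fun y => (y - p) * f y) (𝓝[≠] p) (𝓝 0) →
      (fun z => f z - f p) =o[𝓝[≠] p] fun z => (z - p)⁻¹ := by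
    intro f p h
    rw [Asymptotics.isLittleO_iff_tendsto']
    · have h3 : Tendsto (fun y => (y - p) * f p) (𝓝[≠] p) (𝓝 0) := by
        have : Tendsto (fun y => (y - p) * f p) (𝓝 p) (𝓝 ((p - p) * f p)) :=
          (by fun_prop : Continuous fun y => (y - p) * f p).tendsto p
        rw [sub_self, zero_mul] at this
        exact this.mono_left nhdsWithin_le_nhds
      have := h.sub h3
      rw [sub_zero] at this
      refine this.congr (fun y => ?_)
      rw [div_inv_eq_mul]
      ring
    · filter_upwards [self_mem_nhdsWithin] with y hy h0
      exact absurd (inv_eq_zero.mp h0) (sub_ne_zero.mpr hy)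
  have hpS : p ∈ mlS := by simp only [mlS, Set.mem_ofPred_eq]; linarith
  have hqS : q ∈ mlS := by simp only [mlS, Set.mem_ofPred_eq]; linarith
  set f1 := Function.update f p (limUnder (𝓝[≠] p) f) with hf1
  have d1 : DifferentiableOn ℂ f1 (mlS \ {q}) := by
    apply Complex.differentiableOn_update_limUnder_of_isLittleO
    · exact (mlS_open.sdiff isClosed_singleton).mem_nhds ⟨hpS, hpq⟩
    · refine hf.mono ?_
      rintro y ⟨⟨h3, h4⟩, h5⟩
      refine ⟨h3, ?_⟩
      simp only [Set.mem_insert_iff, Set.mem_singleton_iff, not_or] at *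
      exact ⟨h5, h4⟩
    · exact key f p h1
  refine ⟨Function.update f1 q (limUnder (𝓝[≠] q) f1), ?_, ?_⟩
  · apply Complex.differentiableOn_update_limUnder_of_isLittleO (mlS_open.mem_nhds hqS) d1
    apply key
    refine h2.congr' ?_
    have : ∀ᶠ y in 𝓝[≠] q, y ≠ p := nhdsWithin_le_nhds (isOpen_ne.mem_nhds hpq.symm)
    filter_upwards [this] with y hy
    rw [hf1, Function.update_of_ne hy]
  · intro y hy1 hy2
    rw [Function.update_of_ne hy2, hf1, Function.update_of_ne hy1]

lemma ml_strip_residue (g : ℂ → ℂ) (p q ρ σ : ℂ) (hpq : p ≠ q) (hp : |p.im| < Real.pi) (hq : |q.im| < Real.pi)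
    (hg : DifferentiableOn ℂ g (mlS \ {p, q}))
    (h1 : Tendsto (fun y => (y - p) * g y) (𝓝[≠] p) (𝓝 ρ))
    (h2 : Tendsto (fun y => (y - q) * g y) (𝓝[≠] q) (𝓝 σ))
    (hv : ∀ ε > 0, ∀ᶠ R : ℝ in atTop, ∀ t : ℝ, |t| ≤ Real.pi →
      ‖g (R + t * Complex.I)‖ ≤ ε ∧ ‖g (-R + t * Complex.I)‖ ≤ ε) :
    Tendsto (fun R : ℝ => ∫ x in (-R)..R, (g (x - Real.pi * Complex.I) - g (x + Real.pi * Complex.I)))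
      atTop (𝓝 (2 * Real.pi * Complex.I * (ρ + σ))) := by
  have hpi := Real.pi_pos
  set f : ℂ → ℂ := fun y => g y - ρ * (y - p)⁻¹ - σ * (y - q)⁻¹ with hf
  have hfd : DifferentiableOn ℂ f (mlS \ {p, q}) := by
    refine (hg.sub ?_).sub ?_
    · refine DifferentiableOn.const_mul (DifferentiableOn.inv (by fun_prop) ?_) _
      rintro y ⟨_, hy⟩
      simp only [Set.mem_insert_iff, Set.mem_singleton_iff, not_or] at hy
      exact sub_ne_zero.mpr hy.1
    · refine DifferentiableOn.const_mul (DifferentiableOn.inv (by fun_prop) ?_) _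
      rintro y ⟨_, hy⟩
      simp only [Set.mem_insert_iff, Set.mem_singleton_iff, not_or] at hy
      exact sub_ne_zero.mpr hy.2
  have reg : ∀ p q σ : ℂ, p ≠ q → Tendsto (fun y => (y - p) * (σ * (y - q)⁻¹)) (𝓝[≠] p) (𝓝 0) := by
    intro p q σ hpq
    have : ContinuousAt (fun y => (y - p) * (σ * (y - q)⁻¹)) p := by
      refine ContinuousAt.mul (by fun_prop) (continuousAt_const.mul (ContinuousAt.inv₀ (by fun_prop) (sub_ne_zero.mpr hpq)))
    have h := this.tendsto
    simp only [sub_self, zero_mul] at h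
    exact h.mono_left nhdsWithin_le_nhds
  have sing : ∀ p ρ : ℂ, Tendsto (fun y => (y - p) * (ρ * (y - p)⁻¹)) (𝓝[≠] p) (𝓝 ρ) := by
    intro p ρ
    refine tendsto_const_nhds.congr' ?_
    filter_upwards [self_mem_nhdsWithin] with y hy
    have : y - p ≠ 0 := sub_ne_zero.mpr hy
    field_simp
  obtain ⟨F, hF, hFf⟩ := ml_strip_removable f p q hpq hp hq hfd
    (by
      have := (h1.sub (sing p ρ)).sub (reg p q σ hpq)
      rw [sub_self, sub_zero] at this
      refine this.congr (fun y => ?_)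
      simp only [hf]; ring)
    (by
      have := (h2.sub (reg q p ρ hpq.symm)).sub (sing q σ)
      rw [sub_zero, sub_self] at this
      refine this.congr (fun y => ?_)
      simp only [hf]; ring)
  have invv : ∀ p : ℂ, ∀ ε > 0, ∀ᶠ R : ℝ in atTop, ∀ t : ℝ,
      ‖((R:ℂ) + t * Complex.I - p)⁻¹‖ ≤ ε ∧ ‖(-(R:ℂ) + t * Complex.I - p)⁻¹‖ ≤ ε := by
    intro p ε hε
    filter_upwards [eventually_ge_atTop (|p.re| + ε⁻¹)] with R hR t
    have hε' : 0 < ε⁻¹ := by positivity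
    have hb : ∀ z : ℂ, ε⁻¹ ≤ |z.re| → ‖z⁻¹‖ ≤ ε := by
      intro z hz
      rw [norm_inv]
      exact inv_le_of_inv_le₀ hε (hz.trans (Complex.abs_re_le_norm z))
    have hpr := abs_le.mp (le_refl |p.re|)
    constructor
    · apply hb
      simp
      exact le_trans (by linarith) (le_abs_self _)
    · apply hb
      simp
      exact le_trans (by linarith) (neg_le_abs _)
  have hFv : ∀ ε > 0, ∀ᶠ R : ℝ in atTop, ∀ t : ℝ, |t| ≤ Real.pi →
      ‖F (R + t * Complex.I)‖ ≤ ε ∧ ‖F (-R + t * Complex.I)‖ ≤ ε := by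
    intro ε hε
    set η := ε / (1 + ‖ρ‖ + ‖σ‖) with hη
    have hη0 : 0 < η := by positivity
    have hηε : η + ‖ρ‖ * η + ‖σ‖ * η = ε := by rw [hη]; field_simp
    filter_upwards [hv η hη0, invv p η hη0, invv q η hη0, eventually_gt_atTop (|p.re| + |q.re|)]
      with R e1 e2 e3 e4 t ht
    have hpr := abs_le.mp (le_refl |p.re|)
    have hqr := abs_le.mp (le_refl |q.re|)
    have hp0 := abs_nonneg p.re
    have hq0 := abs_nonneg q.re
    have fb : ∀ y : ℂ, ‖g y‖ ≤ η → ‖(y - p)⁻¹‖ ≤ η → ‖(y - q)⁻¹‖ ≤ η → y ≠ p → y ≠ q → ‖F y‖ ≤ ε := by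
      intro y k1 k2 k3 k4 k5
      rw [hFf y k4 k5]
      calc ‖f y‖ ≤ ‖g y‖ + ‖ρ * (y - p)⁻¹‖ + ‖σ * (y - q)⁻¹‖ :=
            (norm_sub_le _ _).trans (add_le_add_left (norm_sub_le _ _) _)
        _ ≤ η + ‖ρ‖ * η + ‖σ‖ * η := by
            rw [norm_mul, norm_mul]
            gcongr
        _ = ε := hηε
    constructor
    · apply fb _ (e1 t ht).1 (e2 t).1 (e3 t).1
      · intro h; have := congrArg Complex.re h; simp at this; linarith
      · intro h; have := congrArg Complex.re h; simp at this; linarith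
    · apply fb _ (e1 t ht).2 (e2 t).2 (e3 t).2
      · intro h; have := congrArg Complex.re h; simp at this; linarith
      · intro h; have := congrArg Complex.re h; simp at this; linarith
  have h0 := ml_strip_zero F hF hFv
  obtain ⟨hp1, hp2⟩ := abs_lt.mp hp
  obtain ⟨hq1, hq2⟩ := abs_lt.mp hq
  have ltop : ∀ p : ℂ, -Real.pi < p.im → p.im < Real.pi → Tendsto (fun R : ℝ => ∫ x in (-R)..R, ((x:ℂ) + (Real.pi * Complex.I - p))⁻¹) atTop (𝓝 (-(Real.pi * Complex.I))) :=
    fun p h3 h4 => ml_log_lim _ (by simp; linarith)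
  have lbot : ∀ p : ℂ, -Real.pi < p.im → p.im < Real.pi → Tendsto (fun R : ℝ => ∫ x in (-R)..R, ((x:ℂ) + (-Real.pi * Complex.I - p))⁻¹) atTop (𝓝 (Real.pi * Complex.I)) :=
    fun p h3 h4 => ml_log_lim_neg _ (by simp; linarith)
  have hfin := ((h0.add (((lbot p hp1 hp2).sub (ltop p hp1 hp2)).const_mul ρ)).add
    (((lbot q hq1 hq2).sub (ltop q hq1 hq2)).const_mul σ))
  have hc : (0:ℂ) + ρ * (Real.pi * Complex.I - -(Real.pi * Complex.I)) + σ * (Real.pi * Complex.I - -(Real.pi * Complex.I)) =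
      2 * Real.pi * Complex.I * (ρ + σ) := by ring
  rw [hc] at hfin
  refine hfin.congr (fun R => ?_)
  have imt : ∀ x : ℝ, ((x:ℂ) + Real.pi * Complex.I).im = Real.pi := by intro x; simp
  have imb : ∀ x : ℝ, ((x:ℂ) - Real.pi * Complex.I).im = -Real.pi := by intro x; simp
  have neb : ∀ p : ℂ, |p.im| < Real.pi → ∀ x : ℝ, (x:ℂ) - Real.pi * Complex.I ≠ p := by
    intro p hp x h
    rw [← h, imb, abs_neg, abs_of_pos hpi] at hp
    exact lt_irrefl _ hp
  have net : ∀ p : ℂ, |p.im| < Real.pi → ∀ x : ℝ, (x:ℂ) + Real.pi * Complex.I ≠ p := by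
    intro p hp x h
    rw [← h, imt, abs_of_pos hpi] at hp
    exact lt_irrefl _ hp
  have cinvt : ∀ p : ℂ, |p.im| < Real.pi → Continuous (fun x : ℝ => ((x:ℂ) + (Real.pi * Complex.I - p))⁻¹) := by
    intro p hp
    refine Continuous.inv₀ (by fun_prop) (fun x => ?_)
    rw [← add_sub_assoc]
    exact sub_ne_zero.mpr (net p hp x)
  have cinvb : ∀ p : ℂ, |p.im| < Real.pi → Continuous (fun x : ℝ => ((x:ℂ) + (-Real.pi * Complex.I - p))⁻¹) := by
    intro p hp
    refine Continuous.inv₀ (by fun_prop) (fun x => ?_)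
    have := sub_ne_zero.mpr (neb p hp x)
    intro h
    apply this
    rw [← h]; ring
  have cFt : Continuous (fun x : ℝ => F (x + Real.pi * Complex.I)) := by
    refine hF.continuousOn.comp_continuous (by fun_prop) (fun x => ?_)
    simp only [mlS, Set.mem_ofPred_eq, imt, abs_of_pos hpi]; linarith
  have cFb : Continuous (fun x : ℝ => F (x - Real.pi * Complex.I)) := by
    refine hF.continuousOn.comp_continuous (by fun_prop) (fun x => ?_)
    simp only [mlS, Set.mem_ofPred_eq, imb, abs_neg, abs_of_pos hpi]; linarith
  rw [← intervalIntegral.integral_sub (cFb.intervalIntegrable _ _) (cFt.intervalIntegrable _ _),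
    ← intervalIntegral.integral_sub ((cinvb p hp).intervalIntegrable _ _) ((cinvt p hp).intervalIntegrable _ _),
    ← intervalIntegral.integral_sub ((cinvb q hq).intervalIntegrable _ _) ((cinvt q hq).intervalIntegrable _ _),
    ← intervalIntegral.integral_const_mul, ← intervalIntegral.integral_const_mul,
    ← intervalIntegral.integral_add, ← intervalIntegral.integral_add]
  · congr 1
    ext x
    rw [hFf _ (neb p hp x) (neb q hq x), hFf _ (net p hp x) (net q hq x)]
    simp only [hf]
    have t1 : ∀ p : ℂ, (x:ℂ) + (-Real.pi * Complex.I - p) = x - Real.pi * Complex.I - p := by intro p; ring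
    have t2 : ∀ p : ℂ, (x:ℂ) + (Real.pi * Complex.I - p) = x + Real.pi * Complex.I - p := by intro p; ring
    rw [t1, t1, t2, t2]
    ring
  · exact (((cFb.sub cFt).add (((cinvb p hp).sub (cinvt p hp)).const_mul ρ))).intervalIntegrable _ _
  · exact (((cinvb q hq).sub (cinvt q hq)).const_mul σ).intervalIntegrable _ _
  · exact (cFb.sub cFt).intervalIntegrable _ _
  · exact (((cinvb p hp).sub (cinvt p hp)).const_mul ρ).intervalIntegrable _ _

lemma ml_exp_ne (s : ℝ) (hs : 0 < s) (y : ℂ) (hy : y ∈ mlS) (hne : y ≠ (Real.log s : ℝ)) :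
    Complex.exp y - s ≠ 0 := by
  intro h
  have hpi := Real.pi_pos
  have h1 : Complex.exp y = Complex.exp (Real.log s : ℝ) := by
    rw [← Complex.ofReal_exp, Real.exp_log hs]
    exact sub_eq_zero.mp h
  obtain ⟨n, hn⟩ := Complex.exp_eq_exp_iff_exists_int.mp h1
  have him := congrArg Complex.im hn
  simp at him
  have hy' : |y.im| < 3 * Real.pi / 2 := hy
  obtain ⟨h2, h3⟩ := abs_lt.mp hy'
  have hn0 : n = 0 := by
    have h4 : (n:ℝ) < 1 := by nlinarith
    have h5 : (-1:ℝ) < n := by nlinarith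
    have h4' : n < 1 := by exact_mod_cast h4
    have h5' : -1 < n := by exact_mod_cast h5
    omega
  rw [hn0] at hn
  apply hne
  simpa using hn

lemma ml_expa_ne (α : ℝ) (h0 : 0 < α) (h1 : α < 1) (y : ℂ) (hy : y ∈ mlS)
    (hne : y ≠ -(Real.pi / 2 : ℝ) * Complex.I) :
    Complex.exp (α * y) - Complex.exp (α * (-(Real.pi / 2 : ℝ) * Complex.I)) ≠ 0 := by
  intro h
  have hpi := Real.pi_pos
  obtain ⟨n, hn⟩ := Complex.exp_eq_exp_iff_exists_int.mp (sub_eq_zero.mp h)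
  have him := congrArg Complex.im hn
  have him' : α * y.im = α * (-(Real.pi / 2)) + n * (2 * Real.pi) := by
    have e : α * (-(Real.pi / 2 : ℝ) * Complex.I) + n * (2 * Real.pi * Complex.I) =
      ((α * (-(Real.pi / 2)) + n * (2 * Real.pi) : ℝ) : ℂ) * Complex.I := by push_cast; ring
    rw [e, Complex.im_ofReal_mul, Complex.im_ofReal_mul] at him
    simpa using him
  have hy' : |y.im| < 3 * Real.pi / 2 := hy
  obtain ⟨h2, h3⟩ := abs_lt.mp hy'
  have k1 : α * y.im < α * (3 * Real.pi / 2) := by gcongr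
  have k2 : α * (-(3 * Real.pi / 2)) < α * y.im := by gcongr
  have k3 : α * Real.pi < Real.pi := by nlinarith
  have hn0 : n = 0 := by
    have h4 : (n:ℝ) < 1 := by nlinarith
    have h5 : (-1:ℝ) < n := by nlinarith
    have h4' : n < 1 := by exact_mod_cast h4
    have h5' : -1 < n := by exact_mod_cast h5
    omega
  rw [hn0] at hn
  apply hne
  have ha : (α:ℂ) ≠ 0 := by exact_mod_cast h0.ne'
  have hn' : (α:ℂ) * y = α * (-(Real.pi / 2 : ℝ) * Complex.I) := by simpa using hn
  exact mul_left_cancel₀ ha hn'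

lemma ml_slope_lim (f : ℂ → ℂ) (f' p : ℂ) (hf : HasDerivAt f f' p) (hf' : f' ≠ 0) :
    Tendsto (fun y => (y - p) / (f y - f p)) (𝓝[≠] p) (𝓝 f'⁻¹) := by
  have h := (hasDerivAt_iff_tendsto_slope.mp hf).inv₀ hf'
  refine h.congr (fun y => ?_)
  rw [slope_def_field, inv_div]

lemma ml_alg (v l r s : ℂ) (hv : v ≠ 0) (hl : l ≠ 0) (hrs : s + r ≠ 0)
    (h1 : v * l ^ 2 - l ≠ 0) (h2 : v * (l ^ 2)⁻¹ - l ≠ 0) :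
    v * l ^ 2 / (v * l ^ 2 - l) / (-r - s) - v * (l ^ 2)⁻¹ / (v * (l ^ 2)⁻¹ - l) / (-r - s) =
    -Complex.I * ((l ^ 2 - (l ^ 2)⁻¹) * Complex.I / 2 / (((v * l⁻¹ + l * v⁻¹) / 2 - (l ^ 2 + (l ^ 2)⁻¹) / 2)) / (s + r)) := by
  have hrs' : -r - s ≠ 0 := by intro h; apply hrs; linear_combination -h
  have hD : (v * l⁻¹ + l * v⁻¹) / 2 - (l ^ 2 + (l ^ 2)⁻¹) / 2 =
      (v * l ^ 2 - l) * (v * (l ^ 2)⁻¹ - l) / (2 * v * l) := by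
    field_simp
    ring
  rw [hD]
  have h2' : v - l ^ 3 ≠ 0 := by
    intro h; apply h2
    field_simp
    linear_combination h
  have h1' : v * l - 1 ≠ 0 := by
    intro h; apply h1; linear_combination l * h
  have e1 : v * l ^ 2 - l = l * (v * l - 1) := by ring
  have e2 : v * (l ^ 2)⁻¹ - l = (v - l ^ 3) / l ^ 2 := by field_simp
  have e3 : -r - s = -(s + r) := by ring
  rw [e1, e2, e3]
  field_simp
  rw [Complex.I_sq]
  ring

set_option maxHeartbeats 1000000 in
lemma ml_stieltjes (α : ℝ) (h0 : 0 < α) (h1 : α < 1) (s : ℝ) (hs : 1 < s) :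
    ∫ x : ℝ, mlK α x / (s + Real.exp x : ℝ) =
      1 / (α * (s + Complex.I)) -
      (s : ℂ)⁻¹ * (1 - Complex.exp (-Complex.I * Real.pi * α / 2) * ((s ^ α : ℝ) : ℂ)⁻¹)⁻¹ := by
  have hpi := Real.pi_pos
  have hs0 : 0 < s := by linarith
  have ha : (α:ℂ) ≠ 0 := by exact_mod_cast h0.ne'
  have hsc : (s:ℂ) ≠ 0 := by exact_mod_cast hs0.ne'
  set l : ℂ := Complex.exp (-Complex.I * Real.pi * α / 2) with hl
  set q : ℂ := -(Real.pi / 2 : ℝ) * Complex.I with hq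
  set p : ℂ := ((Real.log s : ℝ) : ℂ) with hp
  have hlq : Complex.exp (α * q) = l := by
    rw [hl, hq]; congr 1; push_cast; ring
  have hl0 : l ≠ 0 := Complex.exp_ne_zero _
  have hln : ‖l‖ = 1 := by
    rw [← hlq, Complex.norm_exp, hq]
    simp
  have hep : Complex.exp p = s := by rw [hp, ← Complex.ofReal_exp, Real.exp_log hs0]
  have heq : Complex.exp q = -Complex.I := by
    have : q = -(Real.pi / 2 * Complex.I) := by rw [hq]; push_cast; ring
    rw [this, Complex.exp_neg, Complex.exp_pi_div_two_mul_I, Complex.inv_I]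
  have hpim : p.im = 0 := by rw [hp]; simp
  have hqim : q.im = -(Real.pi / 2) := by rw [hq]; simp
  have hpq : p ≠ q := by
    intro h
    have := congrArg Complex.im h
    rw [hpim, hqim] at this
    linarith
  have hpS : p ∈ mlS := by
    simp only [mlS, Set.mem_ofPred_eq, hpim, abs_zero]; linarith
  have hqS : q ∈ mlS := by
    simp only [mlS, Set.mem_ofPred_eq, hqim, abs_neg]; rw [abs_of_pos (by linarith)]; linarith
  set g : ℂ → ℂ := fun y => Complex.exp (α * y) / (Complex.exp (α * y) - l) / (Complex.exp y - s) with hg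
  have hne1 : ∀ y ∈ mlS, y ≠ p → Complex.exp y - s ≠ 0 := fun y hy hy' => ml_exp_ne s hs0 y hy hy'
  have hne2 : ∀ y ∈ mlS, y ≠ q → Complex.exp (α * y) - l ≠ 0 := by
    intro y hy hy'
    have := ml_expa_ne α h0 h1 y hy hy'
    rw [← hlq]; exact this
  have hgd : DifferentiableOn ℂ g (mlS \ {p, q}) := by
    rintro y ⟨hy, hy'⟩
    simp only [Set.mem_insert_iff, Set.mem_singleton_iff, not_or] at hy'
    have d1 : DifferentiableAt ℂ (fun y : ℂ => Complex.exp (α * y)) y := by fun_prop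
    have d2 : DifferentiableAt ℂ (fun y : ℂ => Complex.exp y - s) y := by fun_prop
    have d3 : DifferentiableAt ℂ (fun y : ℂ => Complex.exp (α * y) - l) y := d1.sub_const l
    exact ((d1.fun_div d3 (hne2 y hy hy'.2)).fun_div d2 (hne1 y hy hy'.1)).differentiableWithinAt
  have hderq : HasDerivAt (fun y : ℂ => Complex.exp (α * y)) (l * α) q := by
    have := ((hasDerivAt_id q).const_mul (α:ℂ)).cexp
    simpa [hlq] using this
  have hderp : HasDerivAt Complex.exp (s:ℂ) p := by
    have := Complex.hasDerivAt_exp p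
    rwa [hep] at this
  have hr1 : Tendsto (fun y => (y - p) * g y) (𝓝[≠] p) (𝓝 (Complex.exp (α * p) / (Complex.exp (α * p) - l) * (s:ℂ)⁻¹)) := by
    have hc : ContinuousAt (fun y : ℂ => Complex.exp (α * y) / (Complex.exp (α * y) - l)) p :=
      ContinuousAt.div (by fun_prop) (by fun_prop) (hne2 p hpS hpq)
    have := (hc.tendsto.mono_left (nhdsWithin_le_nhds (s := {p}ᶜ))).mul (ml_slope_lim _ _ _ hderp hsc)
    refine this.congr (fun y => ?_)
    simp only [hg, hep]
    ring
  have hr2 : Tendsto (fun y => (y - q) * g y) (𝓝[≠] q) (𝓝 (l / (-Complex.I - s) * (l * α)⁻¹)) := by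
    have hc : ContinuousAt (fun y : ℂ => Complex.exp (α * y) / (Complex.exp y - s)) q :=
      ContinuousAt.div (by fun_prop) (by fun_prop) (hne1 q hqS hpq.symm)
    have := (hc.tendsto.mono_left (nhdsWithin_le_nhds (s := {q}ᶜ))).mul (ml_slope_lim _ _ _ hderq (mul_ne_zero hl0 ha))
    simp only [hlq, heq] at this
    refine this.congr (fun y => ?_)
    simp only [hg]
    ring
  have hv : ∀ ε > 0, ∀ᶠ R : ℝ in atTop, ∀ t : ℝ, |t| ≤ Real.pi →
      ‖g (R + t * Complex.I)‖ ≤ ε ∧ ‖g (-R + t * Complex.I)‖ ≤ ε := by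
    intro ε hε
    have ta : Tendsto (fun R : ℝ => Real.exp (α * R)) atTop atTop :=
      Real.tendsto_exp_atTop.comp (tendsto_id.const_mul_atTop h0)
    filter_upwards [ta.eventually_ge_atTop 2, Real.tendsto_exp_atTop.eventually_ge_atTop (s + 2 / ε),
      ta.eventually_ge_atTop (2 / (ε * (s - 1))), eventually_ge_atTop 0] with R k1 k2 k3 k4 t ht
    have n1 : ∀ x : ℝ, ‖Complex.exp (α * (x + t * Complex.I))‖ = Real.exp (α * x) := by
      intro x; rw [Complex.norm_exp]; simp
    have n2 : ∀ x : ℝ, ‖Complex.exp (x + t * Complex.I)‖ = Real.exp x := by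
      intro x; rw [Complex.norm_exp]; simp
    have hsn : ‖(s:ℂ)‖ = s := by rw [Complex.norm_real, Real.norm_of_nonneg hs0.le]
    have h2e : 0 < 2 / ε := by positivity
    constructor
    · simp only [hg]
      rw [norm_div, norm_div, n1]
      have m1 : Real.exp (α * R) / 2 ≤ ‖Complex.exp (α * (R + t * Complex.I)) - l‖ := by
        have := norm_sub_norm_le (Complex.exp (α * (R + t * Complex.I))) l
        rw [n1, hln] at this
        linarith
      have m2 : 2 / ε ≤ ‖Complex.exp (R + t * Complex.I) - s‖ := by
        have := norm_sub_norm_le (Complex.exp (R + t * Complex.I)) s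
        rw [n2, hsn] at this
        linarith
      calc _ ≤ Real.exp (α * R) / (Real.exp (α * R) / 2) / (2 / ε) := by gcongr
        _ = ε := by
          have := (Real.exp_pos (α * R)).ne'
          field_simp
    · have n1' := n1 (-R)
      have n2' := n2 (-R)
      push_cast at n1' n2'
      simp only [hg]
      rw [norm_div, norm_div, n1']
      have hx : Real.exp (α * -R) = (Real.exp (α * R))⁻¹ := by rw [← Real.exp_neg]; ring_nf
      have hx2 : Real.exp (α * -R) ≤ 1 / 2 := by
        rw [hx, one_div]
        exact inv_anti₀ (by norm_num) k1
      have m1 : 1 / 2 ≤ ‖Complex.exp (α * (-R + t * Complex.I)) - l‖ := by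
        have := norm_sub_norm_le l (Complex.exp (α * (-R + t * Complex.I)))
        rw [n1', hln, norm_sub_rev] at this
        linarith
      have m2 : s - 1 ≤ ‖Complex.exp (-R + t * Complex.I) - s‖ := by
        have := norm_sub_norm_le (s:ℂ) (Complex.exp (-R + t * Complex.I))
        rw [n2', hsn, norm_sub_rev] at this
        have : Real.exp (-R) ≤ 1 := Real.exp_le_one_iff.mpr (by linarith)
        linarith
      have hs1 : 0 < s - 1 := by linarith
      have hx3 : Real.exp (α * -R) ≤ (2 / (ε * (s - 1)))⁻¹ := by
        rw [hx]
        exact inv_anti₀ (by positivity) k3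
      calc _ ≤ (2 / (ε * (s - 1)))⁻¹ / (1 / 2) / (s - 1) := by gcongr
        _ = ε := by field_simp
  have hmain := ml_strip_residue g p q _ _ hpq (by rw [hpim]; simpa using hpi)
    (by rw [hqim, abs_neg, abs_of_pos (by linarith)]; linarith) hgd hr1 hr2 hv
  have hjump : ∀ x : ℝ, g (x - Real.pi * Complex.I) - g (x + Real.pi * Complex.I) =
      -(2 * Real.pi * Complex.I) * (mlK α x / (s + Real.exp x : ℝ)) := by
    intro x
    have hinS1 : (x:ℂ) - Real.pi * Complex.I ∈ mlS := by
      simp [mlS]; rw [abs_of_pos hpi]; linarith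
    have hinS2 : (x:ℂ) + Real.pi * Complex.I ∈ mlS := by
      simp [mlS]; rw [abs_of_pos hpi]; linarith
    have hb := hne2 _ hinS1 (by
      intro h; have := congrArg Complex.im h; rw [hqim] at this; simp at this; linarith)
    have ht := hne2 _ hinS2 (by
      intro h; have := congrArg Complex.im h; rw [hqim] at this; simp at this; linarith)
    set v : ℂ := Complex.exp (α * x) with hvdef
    set r : ℂ := Complex.exp x with hrdef
    have hl2 : l ^ 2 = Complex.exp (-(Real.pi * α * Complex.I)) := by
      rw [hl, ← Complex.exp_nat_mul]; congr 1; push_cast; ring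
    have hl2i : (l ^ 2)⁻¹ = Complex.exp (Real.pi * α * Complex.I) := by
      rw [hl2, ← Complex.exp_neg, neg_neg]
    have w1 : Complex.exp (α * (x - Real.pi * Complex.I)) = v * l ^ 2 := by
      rw [hl2, hvdef, ← Complex.exp_add]; ring_nf
    have w2 : Complex.exp (α * (x + Real.pi * Complex.I)) = v * (l ^ 2)⁻¹ := by
      rw [hl2i, hvdef, ← Complex.exp_add]; ring_nf
    have w3 : Complex.exp (x - Real.pi * Complex.I) = -r := by
      rw [Complex.exp_sub, Complex.exp_pi_mul_I, div_neg, div_one]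
    have w4 : Complex.exp (x + Real.pi * Complex.I) = -r := by
      rw [Complex.exp_add, Complex.exp_pi_mul_I]; simp [hrdef]
    have hsr : (s:ℂ) + r ≠ 0 := by
      rw [hrdef, ← Complex.ofReal_exp, ← Complex.ofReal_add]
      have := Real.exp_pos x
      exact_mod_cast (by linarith : 0 < s + Real.exp x).ne'
    rw [w1] at hb
    rw [w2] at ht
    have key := ml_alg v l r s (Complex.exp_ne_zero _) hl0 hsr hb ht
    simp only [hg]
    rw [w1, w2, w3, w4, key]
    have hli : l⁻¹ = Complex.exp ((Real.pi * α / 2 : ℝ) * Complex.I) := by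
      rw [hl, ← Complex.exp_neg]; congr 1; push_cast; ring
    have hD : mlD α x = (v * l⁻¹ + l * v⁻¹) / 2 - (l ^ 2 + (l ^ 2)⁻¹) / 2 := by
      unfold mlD
      have hz : Complex.exp (α * x + (Real.pi * α / 2 : ℝ) * Complex.I) = v * l⁻¹ := by
        rw [hli, Complex.exp_add]
      have hcos : ((Real.cos (Real.pi * α) : ℝ) : ℂ) = (l ^ 2 + (l ^ 2)⁻¹) / 2 := by
        rw [hl2i, hl2, Complex.ofReal_cos, Complex.cos]
        push_cast
        rw [neg_mul]
        ring
      rw [hcos, Complex.cosh, Complex.exp_neg, hz, mul_inv, inv_inv]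
      ring
    have hsin : ((Real.sin (Real.pi * α) : ℝ) : ℂ) = (l ^ 2 - (l ^ 2)⁻¹) * Complex.I / 2 := by
      rw [hl2i, hl2, Complex.ofReal_sin, Complex.sin]
      push_cast
      rw [neg_mul]
    unfold mlK
    rw [← hD, ← hsin]
    have hpc : (Real.pi : ℂ) ≠ 0 := by exact_mod_cast hpi.ne'
    push_cast
    rw [← hrdef]
    field_simp
  simp_rw [hjump] at hmain
  have hint : Integrable (fun x : ℝ => -(2 * Real.pi * Complex.I) * (mlK α x / (s + Real.exp x : ℝ))) := by
    refine Integrable.const_mul ?_ _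
    have hK := mlK_cont α h0 h1
    refine (mlK_integrable α h0 h1).mono ?_ ?_
    · apply Continuous.aestronglyMeasurable
      refine Continuous.div hK (by fun_prop) (fun x => ?_)
      have := Real.exp_pos x
      exact_mod_cast (by linarith : 0 < s + Real.exp x).ne'
    · filter_upwards with x
      have := Real.exp_pos x
      rw [norm_div, Complex.norm_real, Real.norm_of_nonneg (by linarith)]
      exact div_le_self (norm_nonneg _) (by linarith)
  have hlim := intervalIntegral_tendsto_integral hint tendsto_neg_atTop_atBot tendsto_id
  have hE := tendsto_nhds_unique hlim hmain
  rw [integral_const_mul] at hE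
  have hpc : (2 * Real.pi * Complex.I : ℂ) ≠ 0 := by
    have : (Real.pi : ℂ) ≠ 0 := by exact_mod_cast hpi.ne'
    simp [this]
  have hE2 : ∫ x : ℝ, mlK α x / (s + Real.exp x : ℝ) =
      -(Complex.exp (α * p) / (Complex.exp (α * p) - l) * (s:ℂ)⁻¹ + l / (-Complex.I - s) * (l * α)⁻¹) := by
    apply mul_left_cancel₀ hpc
    linear_combination -hE
  rw [hE2]
  have hsa : Complex.exp (α * p) = ((s ^ α : ℝ) : ℂ) := by
    rw [hp, Real.rpow_def_of_pos hs0]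
    push_cast
    rw [mul_comm]
  have hd := hne2 p hpS hpq
  rw [hsa] at hd ⊢
  have hsa0 : ((s ^ α : ℝ) : ℂ) ≠ 0 := by
    exact_mod_cast (Real.rpow_pos_of_pos hs0 α).ne'
  have hsI : (s:ℂ) + Complex.I ≠ 0 := by
    intro h; have := congrArg Complex.re h; simp at this; linarith
  have e1 : (1 - l * ((s ^ α : ℝ) : ℂ)⁻¹)⁻¹ = ((s ^ α : ℝ) : ℂ) / (((s ^ α : ℝ) : ℂ) - l) := by
    rw [← inv_div]; congr 1; field_simp
  have e2 : l / (-Complex.I - s) * (l * α)⁻¹ = -(1 / (α * (s + Complex.I))) := by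
    have : -Complex.I - (s:ℂ) = -(s + Complex.I) := by ring
    rw [this]
    field_simp
  rw [e1, e2]
  ring

lemma ml_rep (α : ℝ) (h0 : 0 < α) (h1 : α < 1) (X : ℝ) (hX : 0 < X) :
    mlE α 1 (Complex.exp (-Complex.I * Real.pi * α / 2) * (X ^ α : ℝ)) =
      Complex.exp (-Complex.I * X) / α - mlI α X := by
  set l : ℂ := Complex.exp (-Complex.I * Real.pi * α / 2) with hl
  have hln : ‖l‖ = 1 := by
    have : l = Complex.exp ((-(Real.pi * α / 2) : ℝ) * Complex.I) := by
      rw [hl]; congr 1; push_cast; ring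
    rw [this, Complex.norm_exp_ofReal_mul_I]
  have hsub : ∀ s X : ℝ, (Real.exp (-(s * X)) : ℂ) * (mlE α 1 (l * (X ^ α : ℝ)) -
      (Complex.exp (-Complex.I * X) / α - mlI α X)) =
      (Real.exp (-(s * X)) : ℂ) * mlE α 1 (l * (X ^ α : ℝ)) -
      (Real.exp (-(s * X)) : ℂ) * (Complex.exp (-Complex.I * X) / α - mlI α X) := by
    intro s X; ring
  have key := ml_laplace_unique (fun X : ℝ => mlE α 1 (l * (X ^ α : ℝ)) -
      (Complex.exp (-Complex.I * X) / α - mlI α X)) ?_ ?_ ?_ X hX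
  · exact sub_eq_zero.mp key
  · intro s hs
    simp only [hsub]
    exact (ml_laplace α h0 l hln s hs).1.sub (mlJ_laplace α h0 h1 s hs).1
  · apply ContinuousOn.sub
    · apply (ml_continuous α h0).comp_continuousOn
      apply ContinuousOn.mul continuousOn_const
      apply Complex.continuous_ofReal.comp_continuousOn
      exact (Real.continuous_rpow_const h0.le).continuousOn
    · apply ContinuousOn.sub
      · exact (by fun_prop : Continuous fun X : ℝ => Complex.exp (-Complex.I * X) / α).continuousOn
      · exact (mlI_cont α h0 h1).mono Set.Ioi_subset_Ici_self
  · intro s hs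
    simp only [hsub]
    rw [integral_sub (ml_laplace α h0 l hln s hs).1 (mlJ_laplace α h0 h1 s hs).1,
      (ml_laplace α h0 l hln s hs).2, (mlJ_laplace α h0 h1 s hs).2, ml_stieltjes α h0 h1 s hs]
    ring

lemma mlI_zero (α : ℝ) (h0 : 0 < α) (h1 : α < 1) : mlI α 0 = 1 / α - 1 := by
  set l : ℂ := Complex.exp (-Complex.I * Real.pi * α / 2) with hl
  have c1 : Tendsto (fun X : ℝ => mlE α 1 (l * (X ^ α : ℝ))) (𝓝[>] 0) (𝓝 1) := by
    have : Continuous (fun X : ℝ => mlE α 1 (l * (X ^ α : ℝ))) := by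
      apply (ml_continuous α h0).comp
      apply Continuous.mul continuous_const
      exact Complex.continuous_ofReal.comp (Real.continuous_rpow_const h0.le)
    have h := this.tendsto 0
    rw [Real.zero_rpow h0.ne', Complex.ofReal_zero, mul_zero, ml_zero] at h
    exact h.mono_left nhdsWithin_le_nhds
  have c2 : Tendsto (fun X : ℝ => Complex.exp (-Complex.I * X) / α - mlI α X) (𝓝[>] 0)
      (𝓝 (1 / α - mlI α 0)) := by
    apply Tendsto.sub
    · have h := (by fun_prop : Continuous fun X : ℝ => Complex.exp (-Complex.I * X) / α).tendsto 0
      simp only [Complex.ofReal_zero, mul_zero, Complex.exp_zero] at h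
      exact h.mono_left nhdsWithin_le_nhds
    · exact (mlI_cont α h0 h1 0 Set.self_mem_Ici).mono_left (nhdsWithin_mono _ Set.Ioi_subset_Ici_self)
  have c3 := c1.congr' (f₂ := fun X : ℝ => Complex.exp (-Complex.I * X) / α - mlI α X) (by
    filter_upwards [self_mem_nhdsWithin] with X hX
    exact ml_rep α h0 h1 X hX)
  have := tendsto_nhds_unique c3 c2
  linear_combination this

lemma ml_quad (c C : ℝ) (hc : 1 / 2 ≤ c) (hc1 : c < 1) (hC : 1 ≤ C) :
    (C ^ 2 - 1) * (1 - c ^ 2) ≤ 3 * (C * c - (2 * c ^ 2 - 1)) ^ 2 := by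
  suffices h : 0 ≤ (4 * c ^ 2 - 1) * C ^ 2 + 6 * c * (1 - 2 * c ^ 2) * C +
      3 * (1 - 2 * c ^ 2) ^ 2 + (1 - c ^ 2) by nlinarith
  have hy : 0 ≤ 4 * c ^ 2 - 1 := by nlinarith
  have hy1 : 0 ≤ 1 - c ^ 2 := by nlinarith
  rcases le_or_gt (c ^ 2) (1 / 2) with h | h
  · have : 0 ≤ 1 - 2 * c ^ 2 := by linarith
    have : 0 ≤ c := by linarith
    have : 0 ≤ C := by linarith
    positivity
  · have hA : 0 < 4 * c ^ 2 - 1 := by linarith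
    refine nonneg_of_mul_nonneg_right (?_ : 0 ≤ (4 * c ^ 2 - 1) * _) hA
    have e : (4 * c ^ 2 - 1) * ((4 * c ^ 2 - 1) * C ^ 2 + 6 * c * (1 - 2 * c ^ 2) * C +
      3 * (1 - 2 * c ^ 2) ^ 2 + (1 - c ^ 2)) = ((4 * c ^ 2 - 1) * C + 3 * c * (1 - 2 * c ^ 2)) ^ 2 +
      4 * (c ^ 2 - 1) ^ 2 * (3 * c ^ 2 - 1) := by ring
    rw [e]
    have : 0 ≤ 3 * c ^ 2 - 1 := by linarith
    positivity

lemma ml_sin_pos (α : ℝ) (h0 : 0 < α) (h1 : α < 1) : 0 < Real.sin (Real.pi * α) := by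
  have hp := Real.pi_pos
  exact Real.sin_pos_of_pos_of_lt_pi (by positivity) (by nlinarith)

lemma mlK_re_im (α : ℝ) (h0 : 0 < α) (h1 : α < 1) (hc : 1 / 2 ≤ Real.cos (Real.pi * α / 2)) (x : ℝ) :
    0 ≤ (mlK α x).re ∧ (mlK α x).im ^ 2 ≤ 3 * (mlK α x).re ^ 2 := by
  obtain ⟨hc0, hc1, hc2⟩ := ml_cos_facts α h0 h1
  have hp := Real.pi_pos
  have hs := ml_sin_pos α h0 h1
  set k : ℝ := Real.sin (Real.pi * α) / (2 * Real.pi) with hk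
  have hk0 : 0 < k := by positivity
  have hD : 0 < (mlD α x).re := by
    obtain ⟨δ, hδ, h⟩ := mlD_lower α h0 h1
    exact lt_of_lt_of_le (mul_pos hδ (Real.cosh_pos _)) (h x)
  have hN : 0 < Complex.normSq (mlD α x) := Complex.normSq_pos.mpr (mlD_ne α h0 h1 x)
  have hDD : (mlD α x).im ^ 2 ≤ 3 * (mlD α x).re ^ 2 := by
    rw [mlD_re, mlD_im, hc2]
    have := ml_quad _ _ hc hc1 (Real.one_le_cosh (α * x))
    have e1 := Real.cosh_sq (α * x)
    have e2 := Real.sin_sq_add_cos_sq (Real.pi * α / 2)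
    calc _ = (Real.cosh (α * x) ^ 2 - 1) * (1 - Real.cos (Real.pi * α / 2) ^ 2) := by
          rw [mul_pow, e1, ← e2]; ring
      _ ≤ _ := this
  have hre : (mlK α x).re = k * (mlD α x).re / Complex.normSq (mlD α x) := by
    unfold mlK; rw [← hk, Complex.div_re]; simp
  have him : (mlK α x).im = -(k * (mlD α x).im / Complex.normSq (mlD α x)) := by
    unfold mlK; rw [← hk, Complex.div_im]; simp
  constructor
  · rw [hre]; positivity
  · rw [hre, him]
    have : 0 ≤ (k / Complex.normSq (mlD α x)) ^ 2 := by positivity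
    calc _ = (k / Complex.normSq (mlD α x)) ^ 2 * (mlD α x).im ^ 2 := by ring
      _ ≤ (k / Complex.normSq (mlD α x)) ^ 2 * (3 * (mlD α x).re ^ 2) := by gcongr
      _ = _ := by ring

lemma ml_pt (z : ℂ) (a b : ℝ) (ha : 0 ≤ a) (ha1 : a ≤ 1) (hb : 0 ≤ b) (hb1 : b ≤ 1)
    (hz : 0 ≤ z.re) (hz2 : z.im ^ 2 ≤ 3 * z.re ^ 2) :
    ‖z * a + (starRingEnd ℂ) z * b‖ ≤ 2 * z.re := by
  apply abs_le_of_sq_le_sq' _ (by linarith) |>.2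
  rw [← Complex.normSq_eq_norm_sq, Complex.normSq_apply]
  have e1 : (z * a + (starRingEnd ℂ) z * b).re = z.re * (a + b) := by
    simp; ring
  have e2 : (z * a + (starRingEnd ℂ) z * b).im = z.im * (a - b) := by
    simp; ring
  rw [e1, e2]
  have h1 : (a - b) ^ 2 * z.im ^ 2 ≤ (a - b) ^ 2 * (3 * z.re ^ 2) := by gcongr
  have h2 : a ^ 2 + b ^ 2 - a * b ≤ 1 := by
    nlinarith [mul_nonneg ha hb, mul_nonneg ha (sub_nonneg.2 ha1), mul_nonneg hb (sub_nonneg.2 hb1), mul_nonneg (sub_nonneg.2 ha1) (sub_nonneg.2 hb1)]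
  have h3 : z.re ^ 2 * (a ^ 2 + b ^ 2 - a * b) ≤ z.re ^ 2 * 1 := by gcongr
  nlinarith

lemma mlI_integrable (α : ℝ) (h0 : 0 < α) (h1 : α < 1) (X : ℝ) (hX : 0 ≤ X) :
    Integrable (fun x : ℝ => mlK α x * (Real.exp (-(Real.exp x * X)) : ℝ)) := by
  have := mlK_cont α h0 h1
  refine (mlK_integrable α h0 h1).mono
    (by fun_prop : Continuous fun x => mlK α x * (Real.exp (-(Real.exp x * X)) : ℝ)).aestronglyMeasurable ?_
  filter_upwards with x
  rw [norm_mul, Complex.norm_real, Real.norm_of_nonneg (Real.exp_pos _).le]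
  have : Real.exp (-(Real.exp x * X)) ≤ 1 := by
    rw [Real.exp_le_one_iff]
    have := mul_nonneg (Real.exp_pos x).le hX
    linarith
  exact mul_le_of_le_one_right (norm_nonneg _) this

lemma ml_bound1 (α : ℝ) (h0 : 0 < α) (h1 : α < 1) (hc : 1 / 2 ≤ Real.cos (Real.pi * α / 2))
    (X : ℝ) (hX : 0 < X) : ‖mlI α X‖ < 1 / α := by
  have ha : ∀ x : ℝ, 0 ≤ Real.exp (-(Real.exp x * X)) ∧ Real.exp (-(Real.exp x * X)) ≤ 1 := by
    intro x
    refine ⟨(Real.exp_pos _).le, ?_⟩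
    rw [Real.exp_le_one_iff]
    have := mul_nonneg (Real.exp_pos x).le hX.le
    linarith
  have hi := mlI_integrable α h0 h1 X hX.le
  have hi2 : Integrable (fun x : ℝ => (starRingEnd ℂ) (mlK α x) * (Real.exp (-(Real.exp (-x) * X)) : ℝ)) := by
    have := hi.comp_neg
    simpa only [mlK_neg] using this
  have e2 : ∫ x : ℝ, (starRingEnd ℂ) (mlK α x) * (Real.exp (-(Real.exp (-x) * X)) : ℝ) = mlI α X := by
    unfold mlI
    rw [← integral_neg_eq_self (fun x : ℝ => mlK α x * (Real.exp (-(Real.exp x * X)) : ℝ))]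
    simp only [mlK_neg]
  have e3 : 2 * mlI α X = ∫ x : ℝ, (mlK α x * (Real.exp (-(Real.exp x * X)) : ℝ) +
      (starRingEnd ℂ) (mlK α x) * (Real.exp (-(Real.exp (-x) * X)) : ℝ)) := by
    rw [integral_add hi hi2, e2, two_mul]; rfl
  have hKi := mlK_integrable α h0 h1
  have e4 : ‖2 * mlI α X‖ ≤ ∫ x : ℝ, 2 * (mlK α x).re := by
    rw [e3]
    refine norm_integral_le_of_norm_le (hKi.re.const_mul 2) ?_
    filter_upwards with x
    obtain ⟨r1, r2⟩ := mlK_re_im α h0 h1 hc x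
    exact ml_pt _ _ _ (ha x).1 (ha x).2 (ha (-x)).1 (ha (-x)).2 r1 r2
  have e5 : ∫ x : ℝ, (mlK α x).re = 1 / α - 1 := by
    have h : (∫ x : ℝ, (mlK α x).re) = (∫ x : ℝ, mlK α x).re := integral_re hKi
    rw [h]
    have h2 : ∫ x : ℝ, mlK α x = mlI α 0 := by unfold mlI; simp
    rw [h2, mlI_zero α h0 h1]
    have : (1 / (α:ℂ) - 1) = ((1 / α - 1 : ℝ) : ℂ) := by push_cast; rfl
    rw [this, Complex.ofReal_re]
  rw [integral_const_mul, e5, norm_mul] at e4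
  simp only [Complex.norm_ofNat] at e4
  linarith

lemma ml_bound2 (α : ℝ) (h0 : 0 < α) (h1 : α < 1) (hc : Real.cos (Real.pi * α / 2) < 1 / 2)
    (X : ℝ) (hX : 0 < X) : ‖mlI α X‖ < 1 / α := by
  obtain ⟨hc0, hc1, hc2⟩ := ml_cos_facts α h0 h1
  have hp := Real.pi_pos
  have hs := ml_sin_pos α h0 h1
  have hs1 : Real.sin (Real.pi * α) < 1 := by
    have e := Real.sin_sq_add_cos_sq (Real.pi * α)
    have : 0 < Real.cos (Real.pi * α) ^ 2 := by
      have : Real.cos (Real.pi * α) < 0 := by nlinarith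
      nlinarith
    nlinarith
  have hD : ∀ x, Real.cosh (α * x) ≤ ‖mlD α x‖ := by
    intro x
    refine (abs_le_of_sq_le_sq' ?_ (norm_nonneg _)).2
    rw [← Complex.normSq_eq_norm_sq, Complex.normSq_apply, mlD_re, mlD_im, hc2]
    have e1 := Real.cosh_sq (α * x)
    have e2 := Real.sin_sq_add_cos_sq (Real.pi * α / 2)
    have hC := Real.one_le_cosh (α * x)
    set C := Real.cosh (α * x)
    set S := Real.sinh (α * x)
    set c := Real.cos (Real.pi * α / 2)
    set d := Real.sin (Real.pi * α / 2)
    have hd : d ^ 2 = 1 - c ^ 2 := by linarith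
    have hS : S ^ 2 = C ^ 2 - 1 := by linarith
    have m : 1 ≤ c + (1 - 2 * c ^ 2) := by nlinarith
    have m0 : 0 ≤ 1 - 2 * c ^ 2 := by nlinarith
    have m1 : 0 ≤ c * (1 - 2 * c ^ 2) * (C - 1) := mul_nonneg (mul_nonneg hc0.le m0) (by linarith)
    have e : (C * c - (2 * c ^ 2 - 1)) * (C * c - (2 * c ^ 2 - 1)) + S * d * (S * d) =
      C ^ 2 - 1 + (c + (1 - 2 * c ^ 2)) ^ 2 + 2 * (c * (1 - 2 * c ^ 2) * (C - 1)) := by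
      have : S * d * (S * d) = (C ^ 2 - 1) * (1 - c ^ 2) := by rw [← hd, ← hS]; ring
      rw [this]; ring
    rw [e]
    nlinarith
  have hI : ‖mlI α X‖ ≤ ∫ x : ℝ, Real.sin (Real.pi * α) / Real.pi * (1 + (α * x) ^ 2)⁻¹ := by
    unfold mlI
    refine norm_integral_le_of_norm_le ((integrable_inv_one_add_sq.comp_mul_left' h0.ne').const_mul _) ?_
    filter_upwards with x
    have b1 : Real.exp (-(Real.exp x * X)) ≤ 1 := by
      rw [Real.exp_le_one_iff]
      have := mul_nonneg (Real.exp_pos x).le hX.le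
      linarith
    rw [norm_mul, Complex.norm_real, Real.norm_of_nonneg (Real.exp_pos _).le]
    refine (mul_le_of_le_one_right (norm_nonneg _) b1).trans ?_
    unfold mlK
    rw [norm_div, Complex.norm_real, Real.norm_of_nonneg (by positivity)]
    have b2 := (ml_cosh_lower (α * x)).trans (hD x)
    calc _ ≤ Real.sin (Real.pi * α) / (2 * Real.pi) / ((1 + (α * x) ^ 2) / 2) := by gcongr
      _ = _ := by field_simp
  rw [integral_const_mul, Measure.integral_comp_mul_left (fun y : ℝ => (1 + y ^ 2)⁻¹) α,
    integral_univ_inv_one_add_sq, abs_of_pos (by positivity), smul_eq_mul] at hI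
  refine lt_of_le_of_lt hI ?_
  have : Real.sin (Real.pi * α) / Real.pi * (α⁻¹ * Real.pi) = Real.sin (Real.pi * α) / α := by
    field_simp
  rw [this]
  gcongr

theorem mittagLeffler_no_zeros_on_sector_boundary (α : ℝ) (hα0 : 0 < α) (hα1 : α < 1) :
    ∀ t : ℝ, 0 < t →
      mlE α 1 (Complex.exp (-Complex.I * Real.pi * α / 2) * t) ≠ 0 := by
  intro t ht h
  have hX : 0 < t ^ (1 / α) := Real.rpow_pos_of_pos ht _
  have hXa : (t ^ (1 / α)) ^ α = t := by
    rw [← Real.rpow_mul ht.le, one_div_mul_cancel hα0.ne', Real.rpow_one]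
  have hr := ml_rep α hα0 hα1 _ hX
  rw [hXa, h] at hr
  have hI : mlI α (t ^ (1 / α)) = Complex.exp (-Complex.I * (t ^ (1 / α) : ℝ)) / α := by
    linear_combination hr
  have hn : ‖mlI α (t ^ (1 / α))‖ = 1 / α := by
    rw [hI, norm_div, Complex.norm_real, Real.norm_of_nonneg hα0.le]
    have : -Complex.I * ((t ^ (1 / α) : ℝ) : ℂ) = ((-(t ^ (1 / α)) : ℝ) : ℂ) * Complex.I := by
      push_cast; ring
    rw [this, Complex.norm_exp_ofReal_mul_I]
  rcases le_or_gt (1 / 2) (Real.cos (Real.pi * α / 2)) with hc | hc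
  · exact (ml_bound1 α hα0 hα1 hc _ hX).ne hn
  · exact (ml_bound2 α hα0 hα1 hc _ hX).ne hn
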